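/- Assume r_C > 2·R_th and β₂·P_D < 2·β₁. Then the leader's value function c ↦ U_C(α*(c), c) is strictly increasing on [c_lo, ∞): for all prices c, c' with c_lo ≤ c < c', one has U_C(α*(c), c) < U_C(α*(c'), c'). -/

import Mathlib

/-- The cell-edge-user (leader) payoff U_C(α, c). -/
noncomputable def UC (β₁ r_C c α : ℝ) : ℝ :=
  β₁ * Real.log (α * r_C) + c * (1 - 2 * α)

/-- The price threshold c_lo. -/
noncomputable def clo (β₁ β₂ P_D r_C R_th : ℝ) : ℝ :=
  β₂ * P_D / 2 + β₁ * r_C / (r_C - 2 * R_th)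

/-- The follower best response α*(c). -/
noncomputable def astar (β₁ β₂ P_D r_C R_th c : ℝ) : ℝ :=
  if c ≤ clo β₁ β₂ P_D r_C R_th then R_th / r_C else 1 / 2 - β₁ / (2 * c - β₂ * P_D)

/-- Prices above the threshold exceed the one at which the interior best response vanishes. -/
theorem two_mul_lt_of_clo_le {β₁ β₂ P_D r_C R_th c : ℝ} (hβ₁ : 0 < β₁) (hRth : 0 < R_th)
    (hfeas : 2 * R_th < r_C) (hc : clo β₁ β₂ P_D r_C R_th ≤ c) :
    2 * β₁ < 2 * c - β₂ * P_D := by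
  have hd : 0 < r_C - 2 * R_th := by linarith
  have h : β₁ < β₁ * r_C / (r_C - 2 * R_th) := by
    rw [lt_div_iff₀ hd]
    nlinarith [mul_pos hβ₁ hRth]
  unfold clo at hc
  linarith

/-- The interior formula for the best response is also valid at the threshold price. -/
theorem astar_eq_of_clo_le {β₁ β₂ P_D r_C R_th c : ℝ} (hβ₁ : 0 < β₁) (hrC : 0 < r_C)
    (hfeas : 2 * R_th < r_C) (hc : clo β₁ β₂ P_D r_C R_th ≤ c) :
    astar β₁ β₂ P_D r_C R_th c = 1 / 2 - β₁ / (2 * c - β₂ * P_D) := by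
  unfold astar
  split_ifs with h
  · obtain rfl := le_antisymm h hc
    have hd : r_C - 2 * R_th ≠ 0 := by linarith
    have ht : 2 * clo β₁ β₂ P_D r_C R_th - β₂ * P_D = 2 * (β₁ * r_C / (r_C - 2 * R_th)) := by
      unfold clo
      ring
    rw [ht]
    field_simp
    ring
  · rfl

/-- The leader's payoff along the interior best response increases with the price. -/
theorem UC_interior_lt {β b r c c' : ℝ} (hβ : 0 < β) (hr : 0 < r) (hb : b < 2 * β)
    (hc : 2 * β < 2 * c - b) (hcc' : c < c') :
    UC β r c (1 / 2 - β / (2 * c - b)) < UC β r c' (1 / 2 - β / (2 * c' - b)) := by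
  have ht : 0 < 2 * c - b := by linarith
  have ht' : 0 < 2 * c' - b := by linarith
  have hcu : β / (2 * c - b) * (2 * c - b) = β := div_mul_cancel₀ _ ht.ne'
  have hcu' : β / (2 * c' - b) * (2 * c' - b) = β := div_mul_cancel₀ _ ht'.ne'
  have hu' : 0 < β / (2 * c' - b) := div_pos hβ ht'
  have huu' : β / (2 * c' - b) < β / (2 * c - b) :=
    div_lt_div_of_pos_left hβ ht (by linarith)
  have hu : β / (2 * c - b) < 1 / 2 := by
    rw [div_lt_iff₀ ht]
    linarith
  unfold UC
  generalize β / (2 * c - b) = u at *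
  generalize β / (2 * c' - b) = u' at *
  have ha : 0 < 1 / 2 - u := by linarith
  have ha' : 0 < 1 / 2 - u' := by linarith
  have hlog : Real.log ((1 / 2 - u) * r) - Real.log ((1 / 2 - u') * r) ≤
      (u' - u) / (1 / 2 - u') := by
    rw [Real.log_mul ha.ne' hr.ne', Real.log_mul ha'.ne' hr.ne', add_sub_add_right_eq_sub,
      ← Real.log_div ha.ne' ha'.ne']
    refine (Real.log_le_sub_one_of_pos (div_pos ha ha')).trans_eq ?_
    rw [div_sub_one ha'.ne', sub_sub_sub_cancel_left]
  have hslope : b < β / (1 / 2 - u') := by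
    refine hb.trans ?_
    rw [lt_div_iff₀ ha']
    nlinarith [mul_pos hβ hu']
  have hmul := mul_le_mul_of_nonneg_left hlog hβ.le
  have hgain := mul_lt_mul_of_pos_right hslope (sub_pos.mpr huu')
  have heq : β * ((u' - u) / (1 / 2 - u')) = -(β / (1 / 2 - u') * (u - u')) := by ring
  linarith

/-- if r_C > 2 R_th and β₂ P_D < 2 β₁, the leader's value function
c ↦ U_C(α*(c), c) is strictly increasing on [c_lo, ∞). -/
theorem stmt6 (β₁ β₂ P_D r_C r_D R_th : ℝ)
    (hβ₁ : 0 < β₁) (hβ₂ : 0 < β₂) (hPD : 0 < P_D) (hrC : 0 < r_C) (hrD : 0 < r_D)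
    (hRth : 0 < R_th)
    (hfeas : r_C > 2 * R_th)
    (hsmall : β₂ * P_D < 2 * β₁) :
    ∀ c c' : ℝ, clo β₁ β₂ P_D r_C R_th ≤ c → c < c' →
      UC β₁ r_C c (astar β₁ β₂ P_D r_C R_th c) <
        UC β₁ r_C c' (astar β₁ β₂ P_D r_C R_th c') := by
  intro c c' hc hcc'
  rw [astar_eq_of_clo_le hβ₁ hrC hfeas hc, astar_eq_of_clo_le hβ₁ hrC hfeas (hc.trans hcc'.le)]
  exact UC_interior_lt hβ₁ hrC hsmall (two_mul_lt_of_clo_le hβ₁ hRth hfeas hc) hcc'
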